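/- arXiv:2306.17349 — 2 statements merged into one kernel-verified Lean document; each statement's English description precedes it below -/
import Mathlib

section
/- Let $\ell \geq 1$ and let $A \in \mathbb{Z}^{\ell \times n}$ be such that every $\ell \times (n-1)$ submatrix of $A$ has rank $\ell$ over $\mathbb{Q}$. Then there exist signs $\varepsilon_j \in \{+1, -1\}$ and strictly positive integers $a_1, \dots, a_n$ such that $\sum_{j=1}^{n} a_j \varepsilon_j A_{ij} = 0$ for all $i$; that is, after replacing some columns $A_j$ of $A$ by their negatives, the columns admit a strictly positive integer relation. -/
open Matrix in
/-- If some columns of a matrix, not including column `j`, already have full row rank, then the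
matrix has a kernel vector that is nonzero at `j`. -/
theorem Matrix.exists_mulVec_eq_zero_of_rank_submatrix {K m ι κ : Type*} [Field K] [Fintype m]
    [Fintype ι] [Fintype κ] (B : Matrix m ι K) (e : κ → ι) {j : ι} (he : ∀ k, e k ≠ j)
    (h : (B.submatrix id e).rank = Fintype.card m) :
    ∃ v : ι → K, B *ᵥ v = 0 ∧ v j ≠ 0 := by
  classical
  have htop : LinearMap.range (B.submatrix id e).mulVecLin = ⊤ := by
    apply Submodule.eq_top_of_finrank_eq
    rw [Module.finrank_fintype_fun_eq_card, ← h, Matrix.rank]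
  obtain ⟨u, hu⟩ := LinearMap.range_eq_top.mp htop (B.col j)
  refine ⟨∑ k, u k • Pi.single (e k) 1 - Pi.single j 1, ?_, ?_⟩
  · ext i
    have hi : ∑ k, B i (e k) * u k = B i j := congrFun hu i
    rw [mulVec_sub, ← mulVecLin_apply, map_sum]
    simp [← hi, mul_comm]
  · simp [fun k => (he k).symm]

open Matrix in
/-- An integer matrix whose rational kernel lies in no coordinate hyperplane has an integer kernel
vector with no zero coordinate. -/
theorem Matrix.exists_int_mulVec_eq_zero_forall_ne_zero {m ι : Type*} [Fintype ι]
    (A : Matrix m ι ℤ)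
    (h : ∀ j, ∃ v : ι → ℚ, A.map (Int.cast : ℤ → ℚ) *ᵥ v = 0 ∧ v j ≠ 0) :
    ∃ w : ι → ℤ, A *ᵥ w = 0 ∧ ∀ j, w j ≠ 0 := by
  obtain ⟨v, hv, hv0⟩ := Module.Dual.exists_forall_mem_ne_zero_of_forall_exists
    (LinearMap.ker (A.map (Int.cast : ℤ → ℚ)).mulVecLin)
    (f := fun j => (LinearMap.proj j : (ι → ℚ) →ₗ[ℚ] ℚ))
    (fun j => by simpa using h j)
  obtain ⟨⟨b, hb⟩, hbv⟩ :=
    IsLocalization.exist_integer_multiples_of_finite (nonZeroDivisors ℤ) v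
  choose w hw using hbv
  have hb0 : (b : ℚ) ≠ 0 := by exact_mod_cast nonZeroDivisors.ne_zero hb
  have hw' : ∀ j, (w j : ℚ) = b * v j := by simpa using hw
  refine ⟨w, ?_, fun j hj => ?_⟩
  · ext i
    have hi : ∑ j, (A i j : ℚ) * v j = 0 := congrFun hv i
    have key : ((∑ j, A i j * w j : ℤ) : ℚ) = b * ∑ j, (A i j : ℚ) * v j := by
      push_cast
      rw [Finset.mul_sum]
      exact Finset.sum_congr rfl fun j _ => by rw [hw']; ring
    rw [hi, mul_zero] at key
    exact_mod_cast key
  · have := hw' j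
    rw [hj, Int.cast_zero] at this
    exact mul_ne_zero hb0 (hv0 j) this.symm

/-- Proposition 3.2(1) in weight-matrix form: if every `ℓ × (n-1)` submatrix of `A` has rank
`ℓ` over `ℚ` (i.e. `V` is `1`-modular), then after replacing some columns of `A` by their
negatives (a change of Lagrangian subspace), the columns admit a strictly positive integer
relation. -/
theorem stmt_3 (ℓ n : ℕ) (hℓ : 1 ≤ ℓ) (A : Matrix (Fin ℓ) (Fin n) ℤ)
    (hA : ∀ S : Finset (Fin n), S.card = n - 1 →
        ((A.map (Int.cast : ℤ → ℚ)).submatrix id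
          (fun j : {x // x ∈ S} => (j : Fin n))).rank = ℓ) :
    ∃ (ε : Fin n → ℤ) (a : Fin n → ℤ),
      (∀ j, ε j = 1 ∨ ε j = -1) ∧ (∀ j, 0 < a j) ∧
      ∀ i, ∑ j, a j * ε j * A i j = 0 := by
  obtain ⟨w, hw, hw0⟩ := A.exists_int_mulVec_eq_zero_forall_ne_zero fun j =>
    Matrix.exists_mulVec_eq_zero_of_rank_submatrix _ _
      (fun k => Finset.ne_of_mem_erase k.2)
      ((hA (Finset.univ.erase j) (by simp)).trans (Fintype.card_fin ℓ).symm)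
  refine ⟨fun j => (w j).sign, fun j => |w j|, fun j => ?_, fun j => abs_pos.mpr (hw0 j),
    fun i => ?_⟩
  · rcases lt_or_gt_of_ne (hw0 j) with h | h
    · exact Or.inr (Int.sign_eq_neg_one_of_neg h)
    · exact Or.inl (Int.sign_eq_one_of_pos h)
  · calc ∑ j, |w j| * (w j).sign * A i j = ∑ j, A i j * w j :=
          Finset.sum_congr rfl fun j _ => by rw [mul_comm |w j|, Int.sign_mul_abs, mul_comm]
      _ = 0 := congrFun hw i
end

section
/- Let $k \geq 1$ and let $m = (m_1,\dots,m_k) \in \mathbb{Z}^k$ with all $m_i > 0$ and $\gcd(m_1,\dots,m_k) = 1$, and set $H = \{t \in (\mathbb{C}^{\times})^{k} : \prod_i t_i^{m_i} = 1\}$. Consider the polynomial ring $R = \mathbb{C}[x_1,\dots,x_k,\xi_1,\dots,\xi_k]$, on which each $t \in (\mathbb{C}^{\times})^{k}$ acts by the $\mathbb{C}$-algebra automorphism $\sigma_t$ with $\sigma_t(x_i) = t_i x_i$ and $\sigma_t(\xi_i) = t_i^{-1} \xi_i$. Then a polynomial $p \in R$ satisfies $\sigma_t p = p$ for all $t \in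 H$ if and only if $p$ lies in the $\mathbb{C}$-subalgebra of $R$ generated by $f(\vec{x}) = \prod_{i=1}^{k} x_i^{m_i}$, $f(\vec{\xi}) = \prod_{i=1}^{k} \xi_i^{m_i}$, and the products $x_i \xi_i$ for $i = 1, \dots, k$. -/
open MvPolynomial

/-- A diagonal substitution `X s ↦ w s * X s` scales each coefficient by the corresponding weight. -/
theorem coeff_aeval_C_mul_X {σ R : Type*} [CommSemiring R] (w : σ → R) (p : MvPolynomial σ R)
    (d : σ →₀ ℕ) :
    coeff d (aeval (fun s => C (w s) * X s) p) = (d.prod fun s n => w s ^ n) * coeff d p := by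
  classical
  induction p using MvPolynomial.induction_on' with
  | add p q hp hq => simp only [map_add, coeff_add, hp, hq, mul_add]
  | monomial e a =>
    have h : aeval (fun s => C (w s) * X s) (monomial e a)
        = monomial e (a * e.prod fun s n => w s ^ n) := by
      rw [aeval_monomial, monomial_eq, algebraMap_eq, C_mul, mul_assoc]
      simp only [mul_pow, Finsupp.prod_mul]
      simp only [Finsupp.prod, map_prod, map_pow]
    rw [h, coeff_monomial, coeff_monomial]
    split_ifs with hed
    · rw [hed, mul_comm]
    · rw [mul_zero]

/-- An integer vector orthogonal to everything orthogonal to a primitive vector `m` is an integer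
multiple of `m`. -/
theorem exists_eq_mul_of_forall_sum_eq_zero {ι : Type*} [Fintype ι] (m n : ι → ℤ)
    (hgcd : Finset.univ.gcd m = 1)
    (h : ∀ e : ι → ℤ, ∑ i, e i * m i = 0 → ∑ i, e i * n i = 0) :
    ∃ c : ℤ, ∀ i, n i = c * m i := by
  classical
  have hij : ∀ i j, n i * m j = n j * m i := fun i j => by
    have := h (fun l => m j * Pi.single (M := fun _ => ℤ) i 1 l
      - m i * Pi.single (M := fun _ => ℤ) j 1 l)
      (by simp [sub_mul, Finset.sum_sub_distrib, Pi.single_apply, mul_comm (m i)])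
    simp only [sub_mul, Finset.sum_sub_distrib, Pi.single_apply, mul_ite, mul_one, mul_zero,
      ite_mul, zero_mul, Finset.sum_ite_eq', Finset.mem_univ, if_true] at this
    linear_combination this
  obtain ⟨u, hu⟩ : ∃ u : ι → ℤ, ∑ i, u i * m i = 1 := by
    obtain ⟨u, hu⟩ := Finset.univ.gcd_eq_sum_mul m
    exact ⟨u, by rw [← hgcd, hu]; exact Finset.sum_congr rfl fun i _ => mul_comm _ _⟩
  refine ⟨∑ j, u j * n j, fun i => ?_⟩
  calc n i = n i * ∑ j, u j * m j := by rw [hu, mul_one]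
    _ = _ := by
      rw [Finset.mul_sum, Finset.sum_mul]
      exact Finset.sum_congr rfl fun j _ => by linear_combination u j * hij i j

theorem sum_eq_zero_of_forall_prod_zpow_eq_one {ι : Type*} [Fintype ι] (m n : ι → ℤ)
    (h : ∀ t : ι → ℂˣ, ∏ i, t i ^ m i = 1 → ∏ i, t i ^ n i = 1) (e : ι → ℤ)
    (he : ∑ i, e i * m i = 0) : ∑ i, e i * n i = 0 := by
  set s : ℂˣ := Units.mk0 2 two_ne_zero
  have hs : ∀ a : ι → ℤ, ∏ i, (s ^ e i) ^ a i = s ^ ∑ i, e i * a i := fun a => by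
    simp only [← zpow_mul]
    exact (map_sum (zmultiplesHom (Additive ℂˣ) (Additive.ofMul s)) _ _).symm
  have h1 := h (fun i => s ^ e i) (by rw [hs, he, zpow_zero])
  rw [hs] at h1
  have h2 := congrArg (fun z : ℂˣ => ‖(z : ℂ)‖) h1
  simp only [Units.val_zpow_eq_zpow_val, norm_zpow, Units.val_one, norm_one, s, Units.val_mk0,
    Complex.norm_ofNat] at h2
  exact (zpow_eq_one_iff_right₀ (by norm_num) (by norm_num)).1 h2

theorem monomial_eq_prod_inl_inr {ι R : Type*} [Fintype ι] [CommSemiring R] (d : ι ⊕ ι →₀ ℕ)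
    (a : R) : monomial d a =
      C a * ((∏ i, X (Sum.inl i) ^ d (Sum.inl i)) * ∏ i, X (Sum.inr i) ^ d (Sum.inr i)) := by
  rw [monomial_eq, Finsupp.prod_fintype _ _ (fun _ => pow_zero _), Fintype.prod_sum_type]

/-- Monomials whose weight is a multiple of `m` are products of the generating invariants. -/
theorem monomial_mem_adjoin {ι R : Type*} [Fintype ι] [CommSemiring R] (m : ι → ℤ)
    (hm : ∀ i, 0 < m i) (d : ι ⊕ ι →₀ ℕ) (c : ℤ)
    (hd : ∀ i, (d (Sum.inl i) : ℤ) - d (Sum.inr i) = c * m i) (a : R) :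
    monomial d a ∈ Algebra.adjoin R
      (insert (∏ i, X (Sum.inl i) ^ (m i).toNat : MvPolynomial (ι ⊕ ι) R)
      (insert (∏ i, X (Sum.inr i) ^ (m i).toNat)
        (Set.range (fun i : ι => X (Sum.inl i) * X (Sum.inr i))))) := by
  set S := Algebra.adjoin R
      (insert (∏ i, X (Sum.inl i) ^ (m i).toNat : MvPolynomial (ι ⊕ ι) R)
      (insert (∏ i, X (Sum.inr i) ^ (m i).toNat)
        (Set.range (fun i : ι => X (Sum.inl i) * X (Sum.inr i)))))
  have hx : ∏ i, X (Sum.inl i) ^ (m i).toNat ∈ S := Algebra.subset_adjoin (by simp)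
  have hξ : ∏ i, X (Sum.inr i) ^ (m i).toNat ∈ S := Algebra.subset_adjoin (by simp)
  have hxξ : ∀ i, X (Sum.inl i) * X (Sum.inr i) ∈ S := fun i => Algebra.subset_adjoin (by simp)
  rw [monomial_eq_prod_inl_inr]
  refine S.mul_mem (S.algebraMap_mem a) ?_
  obtain ⟨l, rfl | rfl⟩ := c.eq_nat_or_neg
  · have h : ∀ i, d (Sum.inl i) = (m i).toNat * l + d (Sum.inr i) := fun i => by
      zify
      rw [Int.toNat_of_nonneg (hm i).le]
      linear_combination hd i
    simp only [h, pow_add, pow_mul, Finset.prod_mul_distrib, Finset.prod_pow, mul_assoc]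
    rw [← Finset.prod_mul_distrib]
    simp only [← mul_pow]
    exact S.mul_mem (S.pow_mem hx l) (S.prod_mem fun i _ => S.pow_mem (hxξ i) _)
  · have h : ∀ i, d (Sum.inr i) = d (Sum.inl i) + (m i).toNat * l := fun i => by
      zify
      rw [Int.toNat_of_nonneg (hm i).le]
      linear_combination -hd i
    simp only [h, pow_add, pow_mul, Finset.prod_mul_distrib, Finset.prod_pow, ← mul_assoc]
    rw [← Finset.prod_mul_distrib]
    simp only [← mul_pow]
    exact S.mul_mem (S.prod_mem fun i _ => S.pow_mem (hxξ i) _) (S.pow_mem hξ l)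

/-- Lemma 6.1(2) of the paper: the invariants of `W ⊕ W*` under the subtorus
`H = {t ∈ (ℂˣ)^k : ∏ i, t i ^ m i = 1}` (with all `m i > 0` and `gcd m = 1`), acting on the
polynomial ring by `x_i ↦ t_i x_i`, `ξ_i ↦ t_i⁻¹ ξ_i`, are exactly the subalgebra generated
by `f(x) = ∏ i, x_i ^ m_i`, `f(ξ) = ∏ i, ξ_i ^ m_i` and the products `x_i ξ_i`. -/
theorem stmt_7 (k : ℕ) (hk : 1 ≤ k) (m : Fin k → ℤ)
    (hm : ∀ i, 0 < m i) (hgcd : Finset.univ.gcd m = 1)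
    (p : MvPolynomial (Fin k ⊕ Fin k) ℂ) :
    (∀ t : Fin k → ℂˣ, ∏ i, t i ^ m i = 1 →
      aeval (Sum.elim
        (fun i => C ((t i : ℂ)) * X (Sum.inl i))
        (fun i => C (((t i)⁻¹ : ℂˣ) : ℂ) * X (Sum.inr i))) p = p) ↔
    p ∈ Algebra.adjoin ℂ
      (insert (∏ i, X (Sum.inl i) ^ (m i).toNat
        : MvPolynomial (Fin k ⊕ Fin k) ℂ)
      (insert (∏ i, X (Sum.inr i) ^ (m i).toNat)
        (Set.range (fun i : Fin k => X (Sum.inl i) * X (Sum.inr i))))) := by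
  constructor
  · intro h
    rw [p.as_sum]
    refine Subalgebra.sum_mem _ fun d hd => ?_
    obtain ⟨c, hc⟩ := exists_eq_mul_of_forall_sum_eq_zero m
      (fun i => (d (Sum.inl i) : ℤ) - d (Sum.inr i)) hgcd
      (sum_eq_zero_of_forall_prod_zpow_eq_one _ _ fun t ht => by
        have hw : (Sum.elim (fun i => C ((t i : ℂ)) * X (Sum.inl i))
            (fun i => C (((t i)⁻¹ : ℂˣ) : ℂ) * X (Sum.inr i)) :
              Fin k ⊕ Fin k → MvPolynomial (Fin k ⊕ Fin k) ℂ) =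
            fun s => C ((Sum.elim t (fun i => (t i)⁻¹) s : ℂˣ) : ℂ) * X s := by
          ext1 (i | i) <;> rfl
        have h1 := congrArg (coeff d) (h t ht)
        rw [hw, coeff_aeval_C_mul_X, mul_eq_right₀ (mem_support_iff.1 hd),
          Finsupp.prod_fintype _ _ (fun _ => pow_zero _), Fintype.prod_sum_type] at h1
        simp only [zpow_sub, zpow_natCast, Finset.prod_mul_distrib]
        ext
        simpa using h1)
    exact monomial_mem_adjoin m hm d c hc _
  · intro hp t ht
    have ht' : ∏ i, (t i : ℂ) ^ (m i).toNat = 1 := by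
      rw [← Units.val_one, ← ht, Units.coe_prod]
      refine Finset.prod_congr rfl fun i _ => ?_
      rw [← Units.val_pow_eq_pow_val, ← zpow_natCast, Int.toNat_of_nonneg (hm i).le]
    refine Algebra.adjoin_le (S := AlgHom.equalizer (aeval _) (AlgHom.id ℂ _)) ?_ hp
    rintro _ (rfl | rfl | ⟨i, rfl⟩)
    · have hC : ∏ i, (C (t i : ℂ) : MvPolynomial (Fin k ⊕ Fin k) ℂ) ^ (m i).toNat = 1 := by
        simp only [← map_pow, ← map_prod, ht', C_1]
      simp only [SetLike.mem_coe, AlgHom.mem_equalizer, map_prod, map_pow, aeval_X, Sum.elim_inl, mul_pow,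
        Finset.prod_mul_distrib, hC, one_mul, AlgHom.id_apply]
    · have hC : ∏ i, (C (((t i)⁻¹ : ℂˣ) : ℂ) : MvPolynomial (Fin k ⊕ Fin k) ℂ) ^ (m i).toNat
          = 1 := by
        simp only [← map_pow, ← map_prod, Units.val_inv_eq_inv_val, inv_pow,
          Finset.prod_inv_distrib, ht', inv_one, C_1]
      simp only [SetLike.mem_coe, AlgHom.mem_equalizer, map_prod, map_pow, aeval_X, Sum.elim_inr, mul_pow,
        Finset.prod_mul_distrib, hC, one_mul, AlgHom.id_apply]
    · have hC : (C (t i : ℂ) * C (((t i)⁻¹ : ℂˣ) : ℂ) : MvPolynomial (Fin k ⊕ Fin k) ℂ) = 1 := by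
        rw [← C_mul, Units.mul_inv, C_1]
      simp only [SetLike.mem_coe, AlgHom.mem_equalizer, map_mul, aeval_X, Sum.elim_inl, Sum.elim_inr,
        AlgHom.id_apply]
      linear_combination (X (Sum.inl i) * X (Sum.inr i)) * hC
end
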